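/- Let a', a'' : ℕ → ℝ be sequences with a'_0 = a''_0 = 1, and define a_n := Σ_{j=0}^n binom(n,j) a'_j a''_{n−j}. Define q'_j, q''_j, q_j by the inverse binomial convolutions q'_0 = 1, q'_j = −Σ_{i<j} binom(j,i) q'_i a'_{j−i} (and similarly for q'' from a'' and q from a), and define Q'_k(x) := Σ_j binom(k,j) q'_j x^{k−j}, Q''_k(x) := Σ_j binom(k,j) q''_j x^{k−j}, Q_k(x) := Σ_j binom(k,j) q_j x^{k−j}. Then for all w, z ∈ ℝ and k ≥ 0: Q_k(w + z) = Σ_{j=0}^k binom(k,j) Q'_j(w) Q''_{k−j}(z). -/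

import Mathlib

open scoped BigOperators

open Finset PowerSeries

/-- The exponential generating function `∑ aₙ Xⁿ / n!` of a sequence. -/
noncomputable def expGenFun {K : Type*} [Field K] (a : ℕ → K) : PowerSeries K :=
  PowerSeries.mk fun n => a n / n.factorial

section ExpGenFun

variable {K : Type*} [Field K] [CharZero K]

theorem expGenFun_injective : Function.Injective (expGenFun (K := K)) := by
  intro a b h
  funext n
  have hn := congrArg (coeff n) h
  simp only [expGenFun, coeff_mk] at hn
  exact (div_left_inj' (Nat.cast_ne_zero.2 n.factorial_ne_zero)).1 hn

/-- The exponential generating function of a binomial convolution is the product of the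
exponential generating functions. -/
theorem expGenFun_mul (a b : ℕ → K) :
    expGenFun a * expGenFun b =
      expGenFun fun n => ∑ j ∈ range (n + 1), (n.choose j : K) * a j * b (n - j) := by
  ext n
  simp only [expGenFun, coeff_mul, coeff_mk]
  rw [Nat.sum_antidiagonal_eq_sum_range_succ_mk, sum_div]
  refine sum_congr rfl fun j hj => ?_
  have hn : (n.factorial : K) ≠ 0 := Nat.cast_ne_zero.2 n.factorial_ne_zero
  have hj0 : (j.factorial : K) ≠ 0 := Nat.cast_ne_zero.2 j.factorial_ne_zero
  have hnj : ((n - j).factorial : K) ≠ 0 := Nat.cast_ne_zero.2 (n - j).factorial_ne_zero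
  rw [Nat.cast_choose K (mem_range_succ_iff.1 hj)]
  field_simp

theorem expGenFun_pow_add (x y : K) :
    expGenFun (fun n => (x + y) ^ n) =
      expGenFun (fun n => x ^ n) * expGenFun fun n => y ^ n := by
  rw [expGenFun_mul]
  congr 1
  funext n
  rw [add_pow]
  exact sum_congr rfl fun j _ => by ring

/-- A sequence and its inverse for binomial convolution have inverse exponential generating
functions. -/
theorem expGenFun_mul_eq_one {a q : ℕ → K} (ha : a 0 = 1) (hq0 : q 0 = 1)
    (hq : ∀ j : ℕ, 1 ≤ j → q j = -∑ i ∈ range j, (j.choose i : K) * q i * a (j - i)) :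
    expGenFun q * expGenFun a = 1 := by
  rw [expGenFun_mul]
  ext n
  simp only [expGenFun, coeff_mk, coeff_one]
  rcases n.eq_zero_or_pos with rfl | hn
  · simp [ha, hq0]
  · simp [sum_range_succ, ha, hq n hn, hn.ne']

end ExpGenFun

/-- **Time-space harmonic polynomials of a sum of two independent Lévy processes.**
If `a_n = ∑_j C(n,j) a'_j a''_{n-j}` and `Q, Q', Q''` are the polynomials obtained from the
inverse binomial convolutions `q, q', q''` of `a, a', a''` respectively, then
`Q_k(w + z) = ∑_{j=0}^k C(k,j) Q'_j(w) Q''_{k-j}(z)`. -/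
theorem tsh_sum_of_processes (a' a'' : ℕ → ℝ) (ha'0 : a' 0 = 1) (ha''0 : a'' 0 = 1)
    (a : ℕ → ℝ)
    (ha : ∀ n : ℕ, a n = ∑ j ∈ Finset.range (n + 1), (n.choose j : ℝ) * a' j * a'' (n - j))
    (q' q'' q : ℕ → ℝ) (hq'0 : q' 0 = 1) (hq''0 : q'' 0 = 1) (hq0 : q 0 = 1)
    (hq' : ∀ j : ℕ, 1 ≤ j →
      q' j = -∑ i ∈ Finset.range j, (j.choose i : ℝ) * q' i * a' (j - i))
    (hq'' : ∀ j : ℕ, 1 ≤ j →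
      q'' j = -∑ i ∈ Finset.range j, (j.choose i : ℝ) * q'' i * a'' (j - i))
    (hq : ∀ j : ℕ, 1 ≤ j →
      q j = -∑ i ∈ Finset.range j, (j.choose i : ℝ) * q i * a (j - i))
    (Q' Q'' Q : ℕ → ℝ → ℝ)
    (hQ' : ∀ (k : ℕ) (x : ℝ),
      Q' k x = ∑ j ∈ Finset.range (k + 1), (k.choose j : ℝ) * q' j * x ^ (k - j))
    (hQ'' : ∀ (k : ℕ) (x : ℝ),
      Q'' k x = ∑ j ∈ Finset.range (k + 1), (k.choose j : ℝ) * q'' j * x ^ (k - j))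
    (hQ : ∀ (k : ℕ) (x : ℝ),
      Q k x = ∑ j ∈ Finset.range (k + 1), (k.choose j : ℝ) * q j * x ^ (k - j)) :
    ∀ (w z : ℝ) (k : ℕ),
      Q k (w + z) = ∑ j ∈ Finset.range (k + 1), (k.choose j : ℝ) * Q' j w * Q'' (k - j) z := by
  intro w z k
  have h_a : expGenFun a = expGenFun a' * expGenFun a'' := by
    rw [expGenFun_mul, ← funext ha]
  have ha0 : a 0 = 1 := by simp [ha, ha'0, ha''0]
  have h_one' := expGenFun_mul_eq_one ha'0 hq'0 hq'
  have h_one'' := expGenFun_mul_eq_one ha''0 hq''0 hq''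
  have h_one := expGenFun_mul_eq_one ha0 hq0 hq
  have h_q : expGenFun q = expGenFun q' * expGenFun q'' := by
    rw [h_a] at h_one
    linear_combination expGenFun q' * expGenFun q'' * h_one
      - expGenFun q * expGenFun q'' * expGenFun a'' * h_one' - expGenFun q * h_one''
  have h_Q' : expGenFun (fun n => Q' n w) = expGenFun q' * expGenFun fun n => w ^ n := by
    simp only [expGenFun_mul, hQ']
  have h_Q'' : expGenFun (fun n => Q'' n z) = expGenFun q'' * expGenFun fun n => z ^ n := by
    simp only [expGenFun_mul, hQ'']
  have h_Q : expGenFun (fun n => Q n (w + z)) =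
      expGenFun q * expGenFun fun n => (w + z) ^ n := by
    simp only [expGenFun_mul, hQ]
  have h_prod : expGenFun (fun n => Q n (w + z)) =
      expGenFun (fun n => Q' n w) * expGenFun fun n => Q'' n z := by
    rw [h_Q, h_Q', h_Q'', expGenFun_pow_add, h_q]
    ring
  rw [expGenFun_mul] at h_prod
  exact congrFun (expGenFun_injective h_prod) k
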